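/- arXiv:2408.11255 — 3 statements merged into one kernel-verified Lean document; each statement's English description precedes it below -/
import Mathlib

section
/- Let (Ω, μ) be a probability space and R : Ω → ℝ a nonnegative integrable random variable that is not almost-everywhere constant. Let Π : ℝ → ℝ be strictly concave on ℝ, strictly monotone increasing, with Π(0) = 0. Then for every real P with P ≥ ∫ R dμ, one has ∫ Π(R(ω) − P) dμ(ω) < 0; hence for every r ≥ 0 and every natural number N ≥ 1, (1/N)·∫ Π(R(ω) − P) dμ(ω) − r·P < 0. -/
open MeasureTheory

/-- A concave increasing function vanishing at `0` grows at most linearly. -/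
lemma ConcaveOn.le_map_one_mul_abs_add_one {f : ℝ → ℝ} (hf : ConcaveOn ℝ Set.univ f)
    (hmono : Monotone f) (h0 : f 0 = 0) (y : ℝ) : f y ≤ f 1 * (|y| + 1) := by
  have h1 : 0 ≤ f 1 := h0 ▸ hmono zero_le_one
  rcases le_total y 1 with hy | hy
  · nlinarith [hmono hy, abs_nonneg y]
  · have hpos : 0 < y := by linarith
    have h := hf.2 (Set.mem_univ y) (Set.mem_univ 0) (inv_nonneg.2 hpos.le)
      (sub_nonneg.2 (inv_le_one_of_one_le₀ hy)) (add_sub_cancel _ _)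
    simp only [smul_eq_mul, h0, mul_zero, add_zero, inv_mul_cancel₀ hpos.ne'] at h
    rw [inv_mul_le_iff₀ hpos] at h
    nlinarith [abs_of_pos hpos]

/-- A concave increasing function vanishing at `0`, composed with an integrable function bounded
below, is integrable. -/
lemma ConcaveOn.integrable_comp_of_bddBelow {Ω : Type*} [MeasurableSpace Ω] {μ : Measure Ω}
    [IsFiniteMeasure μ] {f : ℝ → ℝ} (hf : ConcaveOn ℝ Set.univ f) (hmono : Monotone f)
    (h0 : f 0 = 0) {X : Ω → ℝ} (hX : Integrable X μ) {a : ℝ} (ha : ∀ ω, a ≤ X ω) :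
    Integrable (fun ω => f (X ω)) μ := by
  refine Integrable.mono' (g := fun ω => |f a| + f 1 * (|X ω| + 1))
    ((integrable_const _).add ((hX.abs.add (integrable_const 1)).const_mul _))
    (hmono.measurable.comp_aemeasurable hX.aemeasurable).aestronglyMeasurable
    (Filter.Eventually.of_forall fun ω => ?_)
  have h1 : 0 ≤ f 1 := h0 ▸ hmono zero_le_one
  have hlin := hf.le_map_one_mul_abs_add_one hmono h0 (X ω)
  have hnn : 0 ≤ f 1 * (|X ω| + 1) := by positivity
  rw [Real.norm_eq_abs, abs_le]
  constructor
  · linarith [hmono (ha ω), neg_abs_le (f a)]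
  · linarith [abs_nonneg (f a)]

/-- For a strictly concave, strictly increasing risk adjustment `Π` with `Π 0 = 0`,
and a nondegenerate nonnegative integrable payoff `R`, any price `P ≥ ∫ R dμ`
yields `∫ Π (R − P) dμ < 0`; hence the buyer's objective is negative for every
cost of capital `r ≥ 0` and ticket supply `N ≥ 1`. -/
theorem stmt_1 {Ω : Type*} [MeasurableSpace Ω] (μ : Measure Ω) [IsProbabilityMeasure μ]
    (R : Ω → ℝ) (hRint : Integrable R μ) (hRnn : ∀ ω, 0 ≤ R ω)
    (hRnc : ¬ ∃ c : ℝ, R =ᵐ[μ] fun _ => c)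
    (Pi : ℝ → ℝ) (hPiConc : StrictConcaveOn ℝ Set.univ Pi)
    (hPiMono : StrictMono Pi) (hPi0 : Pi 0 = 0) :
    ∀ P : ℝ, (∫ ω, R ω ∂μ) ≤ P →
      (∫ ω, Pi (R ω - P) ∂μ) < 0 ∧
      ∀ r : ℝ, 0 ≤ r → ∀ N : ℕ, 1 ≤ N →
        (1 / (N : ℝ)) * (∫ ω, Pi (R ω - P) ∂μ) - r * P < 0 := by
  intro P hP
  have hint : Integrable (fun ω => R ω - P) μ := hRint.sub (integrable_const P)
  have hPiInt : Integrable (fun ω => Pi (R ω - P)) μ :=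
    hPiConc.concaveOn.integrable_comp_of_bddBelow hPiMono.monotone hPi0 hint (a := -P)
      fun ω => by linarith [hRnn ω]
  have hneg : (∫ ω, Pi (R ω - P) ∂μ) < 0 := by
    rcases hPiConc.ae_eq_const_or_lt_map_average
      (hPiConc.concaveOn.continuousOn isOpen_univ) isClosed_univ (by simp) hint hPiInt with h | h
    · refine absurd ⟨(⨍ ω, (R ω - P) ∂μ) + P, ?_⟩ hRnc
      filter_upwards [h] with ω hω
      exact sub_eq_iff_eq_add.1 hω
    · rw [average_eq_integral, average_eq_integral,
        integral_sub hRint (integrable_const P), integral_const, probReal_univ, one_smul] at h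
      exact h.trans_le (hPi0 ▸ hPiMono.monotone (sub_nonpos.2 hP))
  refine ⟨hneg, fun r hr N hN => ?_⟩
  have hNpos : (0 : ℝ) < 1 / N := by positivity
  have hP0 : 0 ≤ P := (integral_nonneg hRnn).trans hP
  linarith [mul_neg_of_pos_of_neg hNpos hneg, mul_nonneg hr hP0]
end

section
/- Let B be a nonempty finite set of buyers and I ⊆ B a nonempty subset (the large investors). Let G : Ω → ℝ be a nonnegative integrable random variable with ∫ G dμ > 0 (the PBS market payoff), and for each b ∈ B \ I let R_b be a nonnegative integrable random variable with ∫ R_b dμ > 0 (buyer b's payoff, R_b = max(G, X_b)); each i ∈ I has payoff G (no native MEV extraction ability). Let r_b ≥ 0 for all b and N ≥ 1 a natural number. If for every i ∈ I, r_i < (1/N)·min_{b ∈ B \ I} ((1 + r_b·N)·(∫ G dμ)/(∫ R_b dμ) − 1), then for every i ∈ I and every b ∈ B \ I, (∫ G dμ)/(1 + r_i·N) > (∫ R_b dμ)/(1 + r_b·N); consequently every buyer attaining the maximal risk-neutral valuation belongs to I. -/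
open MeasureTheory

/-- Large investors dominate with PBS: if each large investor's capital cost is
below `(1/N)·min_{b ∈ B\I} ((1 + r_b·N)·(∫ G dμ)/(∫ R_b dμ) − 1)`, then each large
investor's risk-neutral valuation `(∫ G dμ)/(1 + r_i·N)` strictly exceeds every
other buyer's valuation `(∫ R_b dμ)/(1 + r_b·N)`; hence every buyer attaining the
maximal valuation is a large investor. -/
theorem stmt_8 {ι : Type*} {Ω : Type*} [DecidableEq ι] [MeasurableSpace Ω]
    (μ : Measure Ω) [IsProbabilityMeasure μ]
    (B : Finset ι) (hB : B.Nonempty) (I : Finset ι) (hI : I.Nonempty) (hIB : I ⊆ B)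
    (hBI : (B \ I).Nonempty)
    (G : Ω → ℝ) (hGint : Integrable G μ) (hGnn : ∀ ω, 0 ≤ G ω)
    (hGpos : 0 < ∫ ω, G ω ∂μ)
    (R : ι → Ω → ℝ) (hRint : ∀ b ∈ B \ I, Integrable (R b) μ)
    (hRnn : ∀ b ∈ B \ I, ∀ ω, 0 ≤ R b ω)
    (hRpos : ∀ b ∈ B \ I, 0 < ∫ ω, R b ω ∂μ)
    (r : ι → ℝ) (hr : ∀ b ∈ B, 0 ≤ r b) (N : ℕ) (hN : 1 ≤ N)
    (hlow : ∀ i ∈ I, r i < (1 / (N : ℝ)) *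
      (B \ I).inf' hBI
        (fun b => (1 + r b * N) * (∫ ω, G ω ∂μ) / (∫ ω, R b ω ∂μ) - 1)) :
    (∀ i ∈ I, ∀ b ∈ B \ I,
      (∫ ω, R b ω ∂μ) / (1 + r b * N) < (∫ ω, G ω ∂μ) / (1 + r i * N)) ∧
    ∀ b ∈ B,
      (∀ c ∈ B,
        (if c ∈ I then (∫ ω, G ω ∂μ) / (1 + r c * N)
          else (∫ ω, R c ω ∂μ) / (1 + r c * N)) ≤
        (if b ∈ I then (∫ ω, G ω ∂μ) / (1 + r b * N)
          else (∫ ω, R b ω ∂μ) / (1 + r b * N))) →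
      b ∈ I := by
  have key : ∀ i ∈ I, ∀ b ∈ B \ I,
      (∫ ω, R b ω ∂μ) / (1 + r b * N) < (∫ ω, G ω ∂μ) / (1 + r i * N) := by
    intro i hi b hb
    have hNpos : (0 : ℝ) < N := by exact_mod_cast hN
    have hri := hr i (hIB hi)
    have hrb := hr b (Finset.mem_sdiff.mp hb).1
    have hR := hRpos b hb
    have hmin := Finset.inf'_le
      (fun b => (1 + r b * N) * (∫ ω, G ω ∂μ) / (∫ ω, R b ω ∂μ) - 1) hb
    have hi_lt := hlow i hi
    rw [one_div_mul_eq_div, lt_div_iff₀ hNpos] at hi_lt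
    have hlt : 1 + r i * N < (1 + r b * N) * (∫ ω, G ω ∂μ) / (∫ ω, R b ω ∂μ) := by
      linarith [hi_lt.trans_le hmin]
    rw [lt_div_iff₀ hR] at hlt
    rw [div_lt_div_iff₀ (by positivity) (by positivity)]
    linarith
  refine ⟨key, fun b hb hmax => ?_⟩
  by_contra hbI
  obtain ⟨i, hi⟩ := hI
  have hle := hmax i (hIB hi)
  rw [if_pos hi, if_neg hbI] at hle
  exact (key i hi b (Finset.mem_sdiff.mpr ⟨hb, hbI⟩)).not_ge hle
end

section
/- Let (Ω, μ) be a probability space, R : Ω → ℝ a nonnegative integrable random variable, and Π : ℝ → ℝ a continuous, monotone increasing function with Π(x) = 0 for all x ≤ 0, such that ω ↦ Π(R(ω)) is integrable. Let r > 0 and let N ≥ 1 be a natural number. Then the acceptance set S := {P ∈ ℝ : P ≥ 0 and (1/N)·∫ Π(R(ω) − P) dμ(ω) − r·P ≥ 0} is nonempty (it contains 0), bounded above, and closed; consequently S has a greatest element, i.e., the buyer's maximal price P̄ := max S is well defined. -/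
open MeasureTheory

/-- The expected value of a continuous monotone nonnegative transform of `R - P` depends
continuously on `P ≥ 0`. -/
theorem continuousOn_integral_comp_sub {Ω : Type*} [MeasurableSpace Ω] {μ : Measure Ω}
    {R : Ω → ℝ} (hR : AEStronglyMeasurable R μ) {f : ℝ → ℝ} (hf : Continuous f)
    (hmono : Monotone f) (hnn : ∀ x, 0 ≤ f x) (hint : Integrable (fun ω => f (R ω)) μ) :
    ContinuousOn (fun P : ℝ => ∫ ω, f (R ω - P) ∂μ) (Set.Ici 0) := by
  refine continuousOn_of_dominated (bound := fun ω => f (R ω)) (fun P _ => ?_)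
    (fun P hP => ae_of_all _ fun ω => ?_) hint (ae_of_all _ fun ω => ?_)
  · exact hf.comp_aestronglyMeasurable (hR.sub aestronglyMeasurable_const)
  · rw [Real.norm_of_nonneg (hnn _)]
    exact hmono (sub_le_self _ hP)
  · exact (hf.comp (continuous_const.sub continuous_id)).continuousOn

/-- Raising `P ≥ 0` does not raise the expected value above its value at `P = 0`. -/
theorem integral_comp_sub_le {Ω : Type*} [MeasurableSpace Ω] {μ : Measure Ω}
    {R : Ω → ℝ} {f : ℝ → ℝ} (hmono : Monotone f) (hnn : ∀ x, 0 ≤ f x)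
    (hint : Integrable (fun ω => f (R ω)) μ) {P : ℝ} (hP : 0 ≤ P) :
    ∫ ω, f (R ω - P) ∂μ ≤ ∫ ω, f (R ω) ∂μ :=
  integral_mono_of_nonneg (ae_of_all _ fun _ => hnn _) hint
    (ae_of_all _ fun _ => hmono (sub_le_self _ hP))

/-- The acceptance set of an Execution Ticket buyer with strictly positive cost of
capital is nonempty (it contains 0), bounded above, and closed; consequently it has
a greatest element, so the buyer's maximal price is well defined. -/
theorem stmt_13 {Ω : Type*} [MeasurableSpace Ω] (μ : Measure Ω) [IsProbabilityMeasure μ]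
    (R : Ω → ℝ) (hRint : Integrable R μ) (hRnn : ∀ ω, 0 ≤ R ω)
    (Pi : ℝ → ℝ) (hPicont : Continuous Pi) (hPimono : Monotone Pi)
    (hPi0 : ∀ x : ℝ, x ≤ 0 → Pi x = 0)
    (hPiRint : Integrable (fun ω => Pi (R ω)) μ)
    (r : ℝ) (hr : 0 < r) (N : ℕ) (hN : 1 ≤ N) :
    (0 : ℝ) ∈ {P : ℝ | 0 ≤ P ∧ (1 / (N : ℝ)) * (∫ ω, Pi (R ω - P) ∂μ) - r * P ≥ 0} ∧
    BddAbove {P : ℝ | 0 ≤ P ∧ (1 / (N : ℝ)) * (∫ ω, Pi (R ω - P) ∂μ) - r * P ≥ 0} ∧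
    IsClosed {P : ℝ | 0 ≤ P ∧ (1 / (N : ℝ)) * (∫ ω, Pi (R ω - P) ∂μ) - r * P ≥ 0} ∧
    ∃ Pbar : ℝ,
      IsGreatest {P : ℝ | 0 ≤ P ∧ (1 / (N : ℝ)) * (∫ ω, Pi (R ω - P) ∂μ) - r * P ≥ 0}
        Pbar := by
  have hnn : ∀ x, 0 ≤ Pi x := fun x =>
    (hPi0 _ (min_le_right x 0)).symm.le.trans (hPimono (min_le_left x 0))
  have hN0 : (0 : ℝ) ≤ 1 / N := by positivity
  set S := {P : ℝ | 0 ≤ P ∧ (1 / (N : ℝ)) * (∫ ω, Pi (R ω - P) ∂μ) - r * P ≥ 0}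
  have hmem : (0 : ℝ) ∈ S := by
    refine ⟨le_rfl, ?_⟩
    rw [mul_zero, sub_zero]
    exact mul_nonneg hN0 (integral_nonneg fun _ => hnn _)
  have hbdd : BddAbove S := by
    refine ⟨(1 / (N : ℝ)) * (∫ ω, Pi (R ω) ∂μ) / r, fun P hP => ?_⟩
    rw [le_div_iff₀' hr]
    exact (sub_nonneg.mp hP.2).trans
      (mul_le_mul_of_nonneg_left (integral_comp_sub_le hPimono hnn hPiRint hP.1) hN0)
  have hclosed : IsClosed S :=
    ((continuousOn_const.mul (continuousOn_integral_comp_sub hRint.aestronglyMeasurable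
      hPicont hPimono hnn hPiRint)).sub
        (continuousOn_const.mul continuousOn_id)).preimage_isClosed_of_isClosed
          isClosed_Ici isClosed_Ici
  exact ⟨hmem, hbdd, hclosed, sSup S, hclosed.csSup_mem ⟨0, hmem⟩ hbdd,
    fun _ hP => le_csSup hbdd hP⟩
end
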